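/- arXiv:1506.02838 — 4 statements merged into one kernel-verified Lean document; each statement's English description precedes it below -/
import Mathlib

section
/- Let u : ℝ × ℝ → ℝ be defined for x > 0 by u(x,y) = artanh((1 + s(x,y)²)^(−1/2)), where s(x,y) = (1 − (x² + y²))/(2x). Then at every point (x,y) with x > 0 and x² + y² < 1, the function u is twice differentiable and satisfies the minimal surface equation for vertical graphs: u_xx(1 + x²u_y²) + u_yy(1 + x²u_x²) − 2x²u_xy·u_x·u_y − x·u_x·(u_x² + u_y²) = 0. -/
noncomputable section

/-- The real inverse hyperbolic tangent: `artanh x = (1/2) * log ((1+x)/(1-x))`. -/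
def artanh (x : ℝ) : ℝ := (1 / 2) * Real.log ((1 + x) / (1 - x))

/-- The function `s(x,y) = (1 - (x² + y²)) / (2x)`. -/
def sFun (p : ℝ × ℝ) : ℝ := (1 - (p.1 ^ 2 + p.2 ^ 2)) / (2 * p.1)

/-- The graph function `u(x,y) = artanh((1 + s(x,y)²)^(-1/2))`. -/
def uFun (p : ℝ × ℝ) : ℝ := artanh ((1 + sFun p ^ 2) ^ (-(1 / 2) : ℝ))

/-- Partial derivative in the first variable. -/
def pderivX (u : ℝ × ℝ → ℝ) (p : ℝ × ℝ) : ℝ := deriv (fun t => u (t, p.2)) p.1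

/-- Partial derivative in the second variable. -/
def pderivY (u : ℝ × ℝ → ℝ) (p : ℝ × ℝ) : ℝ := deriv (fun t => u (p.1, t)) p.2

/-- The half-disc. -/
def HD (p : ℝ × ℝ) : Prop := 0 < p.1 ∧ p.1 ^ 2 + p.2 ^ 2 < 1

/-- The discriminant. -/
def Qf (x y : ℝ) : ℝ := (1 - x ^ 2 - y ^ 2) ^ 2 + 4 * x ^ 2

/-- First partial in x. -/
def Ff (p : ℝ × ℝ) : ℝ :=
  2 * (1 + p.1 ^ 2 - p.2 ^ 2) / ((1 - p.1 ^ 2 - p.2 ^ 2) * Real.sqrt (Qf p.1 p.2))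

/-- First partial in y. -/
def Gf (p : ℝ × ℝ) : ℝ :=
  4 * p.1 * p.2 / ((1 - p.1 ^ 2 - p.2 ^ 2) * Real.sqrt (Qf p.1 p.2))

lemma HD_nhds {p : ℝ × ℝ} (h : HD p) : ∀ᶠ q in nhds p, HD q := by
  have : IsOpen {q : ℝ × ℝ | HD q} := by
    unfold HD
    have h2 : Continuous fun q : ℝ × ℝ => q.1 ^ 2 + q.2 ^ 2 := by fun_prop
    exact (isOpen_lt continuous_const continuous_fst).inter (isOpen_lt h2 continuous_const)
  exact this.mem_nhds h

lemma HD_x {x y : ℝ} (h : HD (x, y)) : ∀ᶠ t in nhds x, HD (t, y) :=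
  (show Continuous fun t : ℝ => (t, y) by fun_prop).continuousAt.eventually (HD_nhds h)

lemma HD_y {x y : ℝ} (h : HD (x, y)) : ∀ᶠ t in nhds y, HD (x, t) :=
  (show Continuous fun t : ℝ => (x, t) by fun_prop).continuousAt.eventually (HD_nhds h)

lemma u_eq {p : ℝ × ℝ} (h : HD p) :
    uFun p = Real.arsinh (2 * p.1 / (1 - p.1 ^ 2 - p.2 ^ 2)) := by
  obtain ⟨x, y⟩ := p
  obtain ⟨hx, hy⟩ := h
  simp only at hx hy ⊢
  have hD : 0 < 1 - x ^ 2 - y ^ 2 := by linarith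
  have hs : sFun (x, y) = (1 - x ^ 2 - y ^ 2) / (2 * x) := by
    simp only [sFun]; congr 1; ring
  unfold uFun artanh Real.arsinh
  rw [hs]
  generalize 1 - x ^ 2 - y ^ 2 = D at hD
  rw [Real.rpow_neg (by positivity), ← Real.sqrt_eq_rpow]
  have e1 : Real.sqrt (1 + (D / (2 * x)) ^ 2) = Real.sqrt (D ^ 2 + 4 * x ^ 2) / (2 * x) := by
    rw [show 1 + (D / (2 * x)) ^ 2 = (D ^ 2 + 4 * x ^ 2) / (2 * x) ^ 2 by field_simp; ring,
      Real.sqrt_div (by positivity), Real.sqrt_sq (by positivity)]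
  have e2 : Real.sqrt (1 + (2 * x / D) ^ 2) = Real.sqrt (D ^ 2 + 4 * x ^ 2) / D := by
    rw [show 1 + (2 * x / D) ^ 2 = (D ^ 2 + 4 * x ^ 2) / D ^ 2 by field_simp; ring,
      Real.sqrt_div (by positivity), Real.sqrt_sq (by positivity)]
  rw [e1, e2]
  have hR2 : Real.sqrt (D ^ 2 + 4 * x ^ 2) ^ 2 = D ^ 2 + 4 * x ^ 2 := Real.sq_sqrt (by positivity)
  have hR : 0 < Real.sqrt (D ^ 2 + 4 * x ^ 2) := by positivity
  generalize Real.sqrt (D ^ 2 + 4 * x ^ 2) = R at *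
  have hRx : 0 < R - 2 * x := by nlinarith [sq_pos_of_pos hD]
  have : (1 + (R / (2 * x))⁻¹) / (1 - (R / (2 * x))⁻¹) = (2 * x / D + R / D) ^ 2 := by
    have h1 : 1 - (R / (2 * x))⁻¹ = (R - 2 * x) / R := by field_simp
    have h2 : 1 + (R / (2 * x))⁻¹ = (R + 2 * x) / R := by field_simp
    rw [h1, h2]
    field_simp
    linear_combination (-(R + 2 * x)) * hR2
  rw [this, Real.log_pow]
  push_cast; ring

lemma sqrt_aux {x y : ℝ} (hD : 0 < 1 - x ^ 2 - y ^ 2) :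
    Real.sqrt (1 + (2 * x / (1 - x ^ 2 - y ^ 2)) ^ 2)
      = Real.sqrt (Qf x y) / (1 - x ^ 2 - y ^ 2) := by
  unfold Qf
  generalize 1 - x ^ 2 - y ^ 2 = D at *
  rw [show 1 + (2 * x / D) ^ 2 = (D ^ 2 + 4 * x ^ 2) / D ^ 2 by field_simp; ring,
      Real.sqrt_div (by positivity), Real.sqrt_sq (by positivity)]

lemma Dx (x y : ℝ) : HasDerivAt (fun t : ℝ => 1 - t ^ 2 - y ^ 2) (-(2 * x)) x := by
  have := (((hasDerivAt_id x).pow 2).const_sub 1).sub_const (y ^ 2)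
  exact this.congr_deriv (by simp)

lemma Dy (x y : ℝ) : HasDerivAt (fun t : ℝ => 1 - x ^ 2 - t ^ 2) (-(2 * y)) y := by
  have := ((hasDerivAt_id y).pow 2).const_sub (1 - x ^ 2)
  exact this.congr_deriv (by simp)

lemma Q_pos {x y : ℝ} (h : HD (x, y)) : 0 < Qf x y := by
  have := h.1
  simp only at this
  unfold Qf; positivity

lemma D_pos {x y : ℝ} (h : HD (x, y)) : 0 < 1 - x ^ 2 - y ^ 2 := by
  have := h.2
  simp only at this
  linarith

lemma Rx {x y : ℝ} (h : HD (x, y)) : HasDerivAt (fun t : ℝ => Real.sqrt (Qf t y))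
    ((4 * x - 2 * x * (1 - x ^ 2 - y ^ 2)) / Real.sqrt (Qf x y)) x := by
  have h1 : HasDerivAt (fun t : ℝ => Qf t y) (8 * x - 4 * x * (1 - x ^ 2 - y ^ 2)) x := by
    have := ((Dx x y).pow 2).add (((hasDerivAt_id x).pow 2).const_mul 4)
    exact this.congr_deriv (by simp; ring)
  have := h1.sqrt (Q_pos h).ne'
  convert this using 1
  have := Real.sqrt_pos.2 (Q_pos h)
  field_simp; ring

lemma Ry {x y : ℝ} (h : HD (x, y)) : HasDerivAt (fun t : ℝ => Real.sqrt (Qf x t))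
    ((- 2 * y * (1 - x ^ 2 - y ^ 2)) / Real.sqrt (Qf x y)) y := by
  have h1 : HasDerivAt (fun t : ℝ => Qf x t) (- 4 * y * (1 - x ^ 2 - y ^ 2)) y := by
    have := ((Dy x y).pow 2).add_const (4 * x ^ 2)
    exact this.congr_deriv (by simp; ring)
  have := h1.sqrt (Q_pos h).ne'
  convert this using 1
  have := Real.sqrt_pos.2 (Q_pos h)
  field_simp; ring

lemma uX {p : ℝ × ℝ} (h : HD p) : pderivX uFun p = Ff p := by
  obtain ⟨x, y⟩ := p
  have hD := D_pos h
  have hR := Real.sqrt_pos.2 (Q_pos h)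
  have e : (fun t => uFun (t, y)) =ᶠ[nhds x]
      fun t => Real.arsinh (2 * t / (1 - t ^ 2 - y ^ 2)) := by
    filter_upwards [HD_x h] with t ht using u_eq ht
  unfold pderivX Ff
  simp only
  rw [e.deriv_eq]
  have := (((hasDerivAt_id x).const_mul 2).div (Dx x y) hD.ne').arsinh
  refine this.deriv.trans ?_
  simp only [id, Pi.div_apply, smul_eq_mul]
  rw [sqrt_aux hD]
  field_simp
  ring

lemma uY {p : ℝ × ℝ} (h : HD p) : pderivY uFun p = Gf p := by
  obtain ⟨x, y⟩ := p
  have hD := D_pos h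
  have hR := Real.sqrt_pos.2 (Q_pos h)
  have e : (fun t => uFun (x, t)) =ᶠ[nhds y]
      fun t => Real.arsinh (2 * x / (1 - x ^ 2 - t ^ 2)) := by
    filter_upwards [HD_y h] with t ht using u_eq ht
  unfold pderivY Gf
  simp only
  rw [e.deriv_eq]
  have := ((hasDerivAt_const y (2 * x)).div (Dy x y) hD.ne').arsinh
  refine this.deriv.trans ?_
  simp only [Pi.div_apply, smul_eq_mul]
  rw [sqrt_aux hD]
  field_simp
  ring

lemma uXX {x y : ℝ} (h : HD (x, y)) : ∃ R, 0 < R ∧ R ^ 2 = Qf x y ∧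
    pderivX uFun (x, y) = 2 * (1 + x ^ 2 - y ^ 2) / ((1 - x ^ 2 - y ^ 2) * R) ∧
    pderivY uFun (x, y) = 4 * x * y / ((1 - x ^ 2 - y ^ 2) * R) ∧
    pderivX (pderivX uFun) (x, y) = (4 * x * ((1 - x ^ 2 - y ^ 2) * R)
      - 2 * (1 + x ^ 2 - y ^ 2) * (-(2 * x) * R + (1 - x ^ 2 - y ^ 2) *
        ((4 * x - 2 * x * (1 - x ^ 2 - y ^ 2)) / R))) / ((1 - x ^ 2 - y ^ 2) * R) ^ 2 ∧
    pderivY (pderivX uFun) (x, y) = (-(4 * y) * ((1 - x ^ 2 - y ^ 2) * R)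
      - 2 * (1 + x ^ 2 - y ^ 2) * (-(2 * y) * R + (1 - x ^ 2 - y ^ 2) *
        ((- 2 * y * (1 - x ^ 2 - y ^ 2)) / R))) / ((1 - x ^ 2 - y ^ 2) * R) ^ 2 ∧
    pderivY (pderivY uFun) (x, y) = (4 * x * ((1 - x ^ 2 - y ^ 2) * R)
      - 4 * x * y * (-(2 * y) * R + (1 - x ^ 2 - y ^ 2) *
        ((- 2 * y * (1 - x ^ 2 - y ^ 2)) / R))) / ((1 - x ^ 2 - y ^ 2) * R) ^ 2 := by
  have hD := D_pos h
  have hR := Real.sqrt_pos.2 (Q_pos h)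
  have hDR := (mul_pos hD hR).ne'
  refine ⟨Real.sqrt (Qf x y), hR, Real.sq_sqrt (Q_pos h).le, uX h, uY h, ?_, ?_, ?_⟩
  · have e : (fun t => pderivX uFun (t, y)) =ᶠ[nhds x] fun t => Ff (t, y) := by
      filter_upwards [HD_x h] with t ht using uX ht
    refine e.deriv_eq.trans ?_
    have n : HasDerivAt (fun t : ℝ => 2 * (1 + t ^ 2 - y ^ 2)) (4 * x) x := by
      have := ((((hasDerivAt_id x).pow 2).const_add 1).sub_const (y ^ 2)).const_mul 2
      exact this.congr_deriv (by simp; ring)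
    exact (n.div ((Dx x y).mul (Rx h)) hDR).deriv
  · have e : (fun t => pderivX uFun (x, t)) =ᶠ[nhds y] fun t => Ff (x, t) := by
      filter_upwards [HD_y h] with t ht using uX ht
    refine e.deriv_eq.trans ?_
    have n : HasDerivAt (fun t : ℝ => 2 * (1 + x ^ 2 - t ^ 2)) (-(4 * y)) y := by
      have := (((hasDerivAt_id y).pow 2).const_sub (1 + x ^ 2)).const_mul 2
      exact this.congr_deriv (by simp; ring)
    exact (n.div ((Dy x y).mul (Ry h)) hDR).deriv
  · have e : (fun t => pderivY uFun (x, t)) =ᶠ[nhds y] fun t => Gf (x, t) := by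
      filter_upwards [HD_y h] with t ht using uY ht
    refine e.deriv_eq.trans ?_
    have n : HasDerivAt (fun t : ℝ => 4 * x * t) (4 * x) y := by
      have := (hasDerivAt_id y).const_mul (4 * x)
      exact this.congr_deriv (by simp)
    exact (n.div ((Dy x y).mul (Ry h)) hDR).deriv

/-- At every point `(x,y)` with `x > 0` and `x² + y² < 1`, the function
`u(x,y) = artanh((1 + s(x,y)²)^(-1/2))` is twice differentiable and satisfies the
minimal surface equation for vertical graphs in `ℍ² × ℝ`. -/
theorem tall_rectangle_graph_is_minimal (x y : ℝ) (hx : 0 < x) (hxy : x ^ 2 + y ^ 2 < 1) :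
    ContDiffAt ℝ 2 uFun (x, y) ∧
    pderivX (pderivX uFun) (x, y) * (1 + x ^ 2 * (pderivY uFun (x, y)) ^ 2)
      + pderivY (pderivY uFun) (x, y) * (1 + x ^ 2 * (pderivX uFun (x, y)) ^ 2)
      - 2 * x ^ 2 * pderivY (pderivX uFun) (x, y) * pderivX uFun (x, y) * pderivY uFun (x, y)
      - x * pderivX uFun (x, y)
          * ((pderivX uFun (x, y)) ^ 2 + (pderivY uFun (x, y)) ^ 2) = 0 := by
  have h : HD (x, y) := ⟨hx, hxy⟩
  have hD := D_pos h
  constructor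
  · have e : uFun =ᶠ[nhds (x, y)]
        fun p => Real.arsinh (2 * p.1 / (1 - p.1 ^ 2 - p.2 ^ 2)) := by
      filter_upwards [HD_nhds h] with q hq using u_eq hq
    refine ContDiffAt.congr_of_eventuallyEq ?_ e
    refine ContDiffAt.arsinh (ContDiffAt.div ?_ ?_ hD.ne') <;> fun_prop
  · obtain ⟨R, hR, hR2, e1, e2, e3, e4, e5⟩ := uXX h
    rw [e1, e2, e3, e4, e5]
    unfold Qf at hR2
    generalize hDD : 1 - x ^ 2 - y ^ 2 = D at *
    have hy : y ^ 2 = 1 - x ^ 2 - D := by linarith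
    field_simp
    rw [hR2, hy]
    ring

end
end

section
/- Let f : ℝ → ℝ be twice continuously differentiable, fix (x,y) with x > 0, set s = (1 − (x² + y²))/(2x), and define u(p,q) = f((1 − (p² + q²))/(2p)) for p > 0. Then the partial derivatives of u at (x,y) satisfy the identity x² · [u_xx(1 + x²u_y²) + u_yy(1 + x²u_x²) − 2x²u_xy·u_x·u_y − x·u_x·(u_x² + u_y²)] = (1 + s²)·f''(s) + 2s·f'(s) + s(1 + s²)·f'(s)³. In particular, u satisfies the minimal surface equation for vertical graphs at (x,y) if and only if (1 + s²)f''(s) + 2s f'(s) + s(1 + s²)f'(s)³ = 0. -/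
noncomputable section

theorem mse_sX (x y : ℝ) (hx : x ≠ 0) :
    HasDerivAt (fun t : ℝ => (1 - (t ^ 2 + y ^ 2)) / (2 * t))
      (-(1 + x ^ 2 - y ^ 2) / (2 * x ^ 2)) x := by
  have h1 : HasDerivAt (fun t : ℝ => 1 - (t ^ 2 + y ^ 2)) (-(2 * x)) x := by
    have := (((hasDerivAt_id x).pow 2).add_const (y ^ 2)).const_sub 1
    refine HasDerivAt.congr_deriv (this) ?_
    simp
  have h2 : HasDerivAt (fun t : ℝ => 2 * t) 2 x := by
    simpa using (hasDerivAt_id x).const_mul 2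
  refine HasDerivAt.congr_deriv (h1.div h2 (by positivity)) ?_
  field_simp
  ring

theorem mse_sY (x y : ℝ) (hx : x ≠ 0) :
    HasDerivAt (fun t : ℝ => (1 - (x ^ 2 + t ^ 2)) / (2 * x)) (-y / x) y := by
  have h1 : HasDerivAt (fun t : ℝ => 1 - (x ^ 2 + t ^ 2)) (-(2 * y)) y := by
    have := (((hasDerivAt_id y).pow 2).const_add (x ^ 2)).const_sub 1
    refine HasDerivAt.congr_deriv (this) ?_
    simp
  refine HasDerivAt.congr_deriv (h1.div_const (2 * x)) ?_
  field_simp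

theorem mse_sXX (x y : ℝ) (hx : x ≠ 0) :
    HasDerivAt (fun t : ℝ => -(1 + t ^ 2 - y ^ 2) / (2 * t ^ 2))
      ((1 - y ^ 2) / x ^ 3) x := by
  have h0 : HasDerivAt (fun t : ℝ => t ^ 2) (2 * x) x := by
    simpa using hasDerivAt_pow 2 x
  have h1 : HasDerivAt (fun t : ℝ => -(1 + t ^ 2 - y ^ 2)) (-(2 * x)) x :=
    ((h0.const_add 1).sub_const (y ^ 2)).neg
  refine HasDerivAt.congr_deriv (h1.div (h0.const_mul 2) (by positivity)) ?_
  field_simp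
  ring

theorem mse_sXY (x y : ℝ) (hx : x ≠ 0) :
    HasDerivAt (fun t : ℝ => -(1 + x ^ 2 - t ^ 2) / (2 * x ^ 2)) (y / x ^ 2) y := by
  have h0 : HasDerivAt (fun t : ℝ => t ^ 2) (2 * y) y := by
    simpa using hasDerivAt_pow 2 y
  refine HasDerivAt.congr_deriv (((h0.const_sub (1 + x ^ 2)).neg).div_const (2 * x ^ 2)) ?_
  field_simp

/-- For a `C²` function `f` and `u(p,q) = f((1 - (p² + q²))/(2p))`, at a point `(x,y)` with
`x > 0` and `s = (1 - (x² + y²))/(2x)`, one has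
`x² · [MSE expression for u] = (1+s²) f''(s) + 2s f'(s) + s(1+s²) f'(s)³`;
in particular `u` satisfies the minimal surface equation for vertical graphs at `(x,y)` iff
`(1+s²) f''(s) + 2s f'(s) + s(1+s²) f'(s)³ = 0`. -/
theorem mse_reduces_to_ode (f : ℝ → ℝ) (hf : ContDiff ℝ 2 f) (x y : ℝ) (hx : 0 < x)
    (s : ℝ) (hs : s = (1 - (x ^ 2 + y ^ 2)) / (2 * x))
    (u : ℝ × ℝ → ℝ) (hu : u = fun p => f ((1 - (p.1 ^ 2 + p.2 ^ 2)) / (2 * p.1))) :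
    x ^ 2 *
        (pderivX (pderivX u) (x, y) * (1 + x ^ 2 * (pderivY u (x, y)) ^ 2)
          + pderivY (pderivY u) (x, y) * (1 + x ^ 2 * (pderivX u (x, y)) ^ 2)
          - 2 * x ^ 2 * pderivY (pderivX u) (x, y) * pderivX u (x, y) * pderivY u (x, y)
          - x * pderivX u (x, y) * ((pderivX u (x, y)) ^ 2 + (pderivY u (x, y)) ^ 2))
      = (1 + s ^ 2) * deriv (deriv f) s + 2 * s * deriv f s
          + s * (1 + s ^ 2) * (deriv f s) ^ 3 ∧
    ((pderivX (pderivX u) (x, y) * (1 + x ^ 2 * (pderivY u (x, y)) ^ 2)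
          + pderivY (pderivY u) (x, y) * (1 + x ^ 2 * (pderivX u (x, y)) ^ 2)
          - 2 * x ^ 2 * pderivY (pderivX u) (x, y) * pderivX u (x, y) * pderivY u (x, y)
          - x * pderivX u (x, y) * ((pderivX u (x, y)) ^ 2 + (pderivY u (x, y)) ^ 2) = 0)
        ↔ (1 + s ^ 2) * deriv (deriv f) s + 2 * s * deriv f s
            + s * (1 + s ^ 2) * (deriv f s) ^ 3 = 0) := by
  have hx0 : x ≠ 0 := hx.ne'
  have hd : Differentiable ℝ f := hf.differentiable (by norm_num)
  have hd2 : Differentiable ℝ (deriv f) := by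
    have h : ContDiff ℝ (1 + 1) f := by simpa [one_add_one_eq_two] using hf
    exact ((contDiff_succ_iff_deriv.1 h).2.2).differentiable (by norm_num)
  have hX : ∀ a b : ℝ, a ≠ 0 → pderivX u (a, b) =
      deriv f ((1 - (a ^ 2 + b ^ 2)) / (2 * a)) * (-(1 + a ^ 2 - b ^ 2) / (2 * a ^ 2)) := by
    intro a b ha
    subst hu
    exact ((hd _).hasDerivAt.comp a (mse_sX a b ha)).deriv
  have hY : ∀ a b : ℝ, a ≠ 0 → pderivY u (a, b) =
      deriv f ((1 - (a ^ 2 + b ^ 2)) / (2 * a)) * (-b / a) := by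
    intro a b ha
    subst hu
    exact ((hd _).hasDerivAt.comp b (mse_sY a b ha)).deriv
  have hXX : pderivX (pderivX u) (x, y) =
      deriv (deriv f) s * (-(1 + x ^ 2 - y ^ 2) / (2 * x ^ 2)) *
        (-(1 + x ^ 2 - y ^ 2) / (2 * x ^ 2)) + deriv f s * ((1 - y ^ 2) / x ^ 3) := by
    have he : (fun t => pderivX u (t, y)) =ᶠ[nhds x] fun t =>
        deriv f ((1 - (t ^ 2 + y ^ 2)) / (2 * t)) * (-(1 + t ^ 2 - y ^ 2) / (2 * t ^ 2)) := by
      filter_upwards [isOpen_ne.mem_nhds hx0] with t ht using hX t y ht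
    show deriv (fun t => pderivX u (t, y)) x = _
    rw [he.deriv_eq, hs]
    exact (((hd2 _).hasDerivAt.comp x (mse_sX x y hx0)).mul (mse_sXX x y hx0)).deriv
  have hXY : pderivY (pderivX u) (x, y) =
      deriv (deriv f) s * (-y / x) *
        (-(1 + x ^ 2 - y ^ 2) / (2 * x ^ 2)) + deriv f s * (y / x ^ 2) := by
    show deriv (fun t => pderivX u (x, t)) y = _
    rw [funext fun t => hX x t hx0, hs]
    exact (((hd2 _).hasDerivAt.comp y (mse_sY x y hx0)).mul (mse_sXY x y hx0)).deriv
  have hYY : pderivY (pderivY u) (x, y) =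
      deriv (deriv f) s * (-y / x) * (-y / x) + deriv f s * (-1 / x) := by
    show deriv (fun t => pderivY u (x, t)) y = _
    rw [funext fun t => hY x t hx0, hs]
    exact (((hd2 _).hasDerivAt.comp y (mse_sY x y hx0)).mul
      ((hasDerivAt_id y).neg.div_const x)).deriv
  have key : ∀ E R : ℝ, x ^ 2 * E = R → (x ^ 2 * E = R ∧ (E = 0 ↔ R = 0)) := by
    intro E R h
    refine ⟨h, ?_⟩
    rw [← h]
    simp [hx0]
  apply key
  rw [hXX, hXY, hYY, hX x y hx0, hY x y hx0, ← hs]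
  generalize deriv (deriv f) s = B
  generalize deriv f s = A
  subst hs
  field_simp
  ring

end
end

section
/- Let C ∈ ℝ, let I ⊆ ℝ be an open interval on which P_C(s) := C − 1 + (2C − 1)s² + C·s⁴ > 0, and let f : ℝ → ℝ satisfy f'(s) = −(P_C(s))^(−1/2) for all s ∈ I. Define u(x,y) = f((1 − (x² + y²))/(2x)) for x > 0. Then at every point (x,y) with x > 0 and (1 − (x² + y²))/(2x) ∈ I, the function u is twice differentiable and satisfies the minimal surface equation for vertical graphs: u_xx(1 + x²u_y²) + u_yy(1 + x²u_x²) − 2x²u_xy·u_x·u_y − x·u_x·(u_x² + u_y²) = 0. -/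
noncomputable section

theorem trm_g_deriv (C s : ℝ) (h : 0 < C - 1 + (2 * C - 1) * s ^ 2 + C * s ^ 4) :
    HasDerivAt (fun s : ℝ => -(C - 1 + (2 * C - 1) * s ^ 2 + C * s ^ 4) ^ (-(1 / 2) : ℝ))
      (-((2 * C - 1) * (2 * s) + C * (4 * s ^ 3)) / 2 *
        (-(C - 1 + (2 * C - 1) * s ^ 2 + C * s ^ 4) ^ (-(1 / 2) : ℝ)) ^ 3) s := by
  have hq : HasDerivAt (fun s : ℝ => C - 1 + (2 * C - 1) * s ^ 2 + C * s ^ 4)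
      ((2 * C - 1) * (2 * s) + C * (4 * s ^ 3)) s := by
    have h2 := ((hasDerivAt_pow 2 s).const_mul (2 * C - 1)).const_add (C - 1)
    have h4 := (hasDerivAt_pow 4 s).const_mul C
    have := h2.add h4
    refine this.congr_deriv ?_
    norm_num
  have h3 := (hq.rpow_const (p := (-(1 / 2) : ℝ)) (Or.inl h.ne')).neg
  refine h3.congr_deriv ?_
  have e : ∀ P : ℝ, 0 < P → P ^ (-(1 / 2) - 1 : ℝ) = (P ^ (-(1 / 2) : ℝ)) ^ 3 := by
    intro P hP
    rw [← Real.rpow_natCast, ← Real.rpow_mul hP.le]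
    norm_num
  rw [e _ h]
  ring

theorem trm_g_sq (P : ℝ) (h : 0 < P) : (-P ^ (-(1 / 2) : ℝ)) ^ 2 * P = 1 := by
  rw [neg_sq, ← Real.rpow_natCast, ← Real.rpow_mul h.le]
  norm_num [Real.rpow_neg_one, h.ne']

theorem trm_Sx (x y : ℝ) (hx : 0 < x) :
    HasDerivAt (fun t : ℝ => (1 - (t ^ 2 + y ^ 2)) / (2 * t))
      (-(1 - y ^ 2 + x ^ 2) / (2 * x ^ 2)) x := by
  have h1 := (((hasDerivAt_pow 2 x).add_const (y ^ 2)).const_sub 1).div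
    ((hasDerivAt_id x).const_mul 2) (by simpa using hx.ne')
  refine h1.congr_deriv ?_
  simp
  field_simp
  ring

theorem trm_Sy (x y : ℝ) (hx : 0 < x) :
    HasDerivAt (fun t : ℝ => (1 - (x ^ 2 + t ^ 2)) / (2 * x)) (-y / x) y := by
  have h1 := (((hasDerivAt_pow 2 y).const_add (x ^ 2)).const_sub 1).div_const (2 * x)
  refine h1.congr_deriv ?_
  simp
  field_simp

theorem trm_Sxx (x y : ℝ) (hx : 0 < x) :
    HasDerivAt (fun t : ℝ => -(1 - y ^ 2 + t ^ 2) / (2 * t ^ 2))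
      ((1 - y ^ 2) / x ^ 3) x := by
  have h1 := (((hasDerivAt_pow 2 x).const_add (1 - y ^ 2)).neg).div
    ((hasDerivAt_pow 2 x).const_mul 2) (by positivity)
  refine h1.congr_deriv ?_
  simp
  field_simp
  ring

theorem trm_Sxy (x y : ℝ) (hx : 0 < x) :
    HasDerivAt (fun t : ℝ => -(1 - t ^ 2 + x ^ 2) / (2 * x ^ 2)) (y / x ^ 2) y := by
  have h1 := ((((hasDerivAt_pow 2 y).const_sub 1).add_const (x ^ 2)).neg).div_const (2 * x ^ 2)
  refine h1.congr_deriv ?_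
  simp
  field_simp

theorem trm_Syy (x y : ℝ) : HasDerivAt (fun t : ℝ => -t / x) (-1 / x) y :=
  ((hasDerivAt_id y).neg).div_const x

/-- Let `I` be an open interval on which `P_C(s) = C - 1 + (2C - 1)s² + C s⁴ > 0`, and let
`f` satisfy `f'(s) = -(P_C(s))^(-1/2)` on `I`.  Then `u(x,y) = f((1 - (x² + y²))/(2x))` is
twice differentiable and satisfies the minimal surface equation for vertical graphs at every
point `(x,y)` with `x > 0` and `(1 - (x² + y²))/(2x) ∈ I`. -/
theorem tall_rectangle_family_is_minimal (C : ℝ) (I : Set ℝ) (hIopen : IsOpen I)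
    (hIinterval : I.OrdConnected)
    (hP : ∀ s ∈ I, 0 < C - 1 + (2 * C - 1) * s ^ 2 + C * s ^ 4)
    (f : ℝ → ℝ)
    (hf : ∀ s ∈ I, HasDerivAt f (-(C - 1 + (2 * C - 1) * s ^ 2 + C * s ^ 4) ^ (-(1 / 2) : ℝ)) s)
    (u : ℝ × ℝ → ℝ) (hu : u = fun p => f ((1 - (p.1 ^ 2 + p.2 ^ 2)) / (2 * p.1)))
    (x y : ℝ) (hx : 0 < x) (hs : (1 - (x ^ 2 + y ^ 2)) / (2 * x) ∈ I) :
    ContDiffAt ℝ 2 u (x, y) ∧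
    pderivX (pderivX u) (x, y) * (1 + x ^ 2 * (pderivY u (x, y)) ^ 2)
      + pderivY (pderivY u) (x, y) * (1 + x ^ 2 * (pderivX u (x, y)) ^ 2)
      - 2 * x ^ 2 * pderivY (pderivX u) (x, y) * pderivX u (x, y) * pderivY u (x, y)
      - x * pderivX u (x, y) * ((pderivX u (x, y)) ^ 2 + (pderivY u (x, y)) ^ 2) = 0 := by
  have hg := fun s hs => trm_g_deriv C s (hP s hs)
  have hsq := trm_g_sq _ (hP _ hs)
  set g : ℝ → ℝ := fun s => -(C - 1 + (2 * C - 1) * s ^ 2 + C * s ^ 4) ^ (-(1 / 2) : ℝ) with hgdef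
  have hfc : ContDiffOn ℝ 2 f I := by
    have hgc : ContDiffOn ℝ 1 g I := by
      intro s hs
      refine ContDiffAt.contDiffWithinAt ?_
      refine ContDiffAt.neg (ContDiffAt.rpow_const_of_ne (by fun_prop) (hP s hs).ne')
    have : ((1 : WithTop ℕ∞) + 1) = 2 := by norm_num
    rw [← this, contDiffOn_succ_iff_deriv_of_isOpen hIopen]
    refine ⟨fun s hs => (hf s hs).differentiableAt.differentiableWithinAt, by simp, ?_⟩
    exact hgc.congr fun s hs => (hf s hs).deriv
  have hfs : ContDiffAt ℝ 2 f ((1 - (x ^ 2 + y ^ 2)) / (2 * x)) :=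
    hfc.contDiffAt (hIopen.mem_nhds hs)
  refine ⟨?_, ?_⟩
  · rw [hu]
    refine ContDiffAt.comp (g := f) (f := fun p : ℝ × ℝ => (1 - (p.1 ^ 2 + p.2 ^ 2)) / (2 * p.1)) (x, y) hfs ?_
    refine ContDiffAt.div (by fun_prop) (by fun_prop) ?_
    simpa using hx.ne'
  have hux : ∀ a b : ℝ, 0 < a → (1 - (a ^ 2 + b ^ 2)) / (2 * a) ∈ I →
      pderivX u (a, b) = g ((1 - (a ^ 2 + b ^ 2)) / (2 * a)) * (-(1 - b ^ 2 + a ^ 2) / (2 * a ^ 2)) := by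
    intro a b ha hab
    rw [hu]
    exact (HasDerivAt.comp (h₂ := f) a (hf _ hab) (trm_Sx a b ha)).deriv
  have huy : ∀ a b : ℝ, 0 < a → (1 - (a ^ 2 + b ^ 2)) / (2 * a) ∈ I →
      pderivY u (a, b) = g ((1 - (a ^ 2 + b ^ 2)) / (2 * a)) * (-b / a) := by
    intro a b ha hab
    rw [hu]
    exact (HasDerivAt.comp (h₂ := f) b (hf _ hab) (trm_Sy a b ha)).deriv
  have evx : ∀ᶠ t in nhds x, 0 < t ∧ (1 - (t ^ 2 + y ^ 2)) / (2 * t) ∈ I :=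
    (lt_mem_nhds hx).and ((trm_Sx x y hx).continuousAt.eventually (hIopen.mem_nhds hs))
  have evy : ∀ᶠ t in nhds y, (1 - (x ^ 2 + t ^ 2)) / (2 * x) ∈ I :=
    (trm_Sy x y hx).continuousAt.eventually (hIopen.mem_nhds hs)
  have gx := HasDerivAt.comp (h₂ := g) x (hg _ hs) (trm_Sx x y hx)
  have gy := HasDerivAt.comp (h₂ := g) y (hg _ hs) (trm_Sy x y hx)
  have hxx := ((gx.mul (trm_Sxx x y hx)).congr_of_eventuallyEq
    (f₁ := fun t => pderivX u (t, y)) (evx.mono fun t ht => hux t y ht.1 ht.2)).deriv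
  have hyx := ((gy.mul (trm_Sxy x y hx)).congr_of_eventuallyEq
    (f₁ := fun t => pderivX u (x, t)) (evy.mono fun t ht => hux x t hx ht)).deriv
  have hyy := ((gy.mul (trm_Syy x y)).congr_of_eventuallyEq
    (f₁ := fun t => pderivY u (x, t)) (evy.mono fun t ht => huy x t hx ht)).deriv
  have exx : pderivX (pderivX u) (x, y) = _ := hxx
  have eyx : pderivY (pderivX u) (x, y) = _ := hyx
  have eyy : pderivY (pderivY u) (x, y) = _ := hyy
  rw [exx, eyx, eyy, hux x y hx hs, huy x y hx hs]
  simp only [Function.comp]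
  change (g ((1 - (x ^ 2 + y ^ 2)) / (2 * x))) ^ 2 * _ = 1 at hsq
  have hfold : -(C - 1 + (2 * C - 1) * ((1 - (x ^ 2 + y ^ 2)) / (2 * x)) ^ 2
      + C * ((1 - (x ^ 2 + y ^ 2)) / (2 * x)) ^ 4) ^ (-(1 / 2) : ℝ)
      = g ((1 - (x ^ 2 + y ^ 2)) / (2 * x)) := rfl
  simp only [hfold]
  generalize g ((1 - (x ^ 2 + y ^ 2)) / (2 * x)) = G at hsq ⊢
  clear hfold hxx hyx hyy exx eyx eyy gx gy
  have hx0 := hx.ne'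
  linear_combination (norm := skip) (-G * ((1 - y ^ 2) / x ^ 3 + -1 / x)) * hsq
  field_simp
  ring

end
end

section
/- Let I ⊆ ℝ be a nonempty open interval and let g : ℝ → ℝ be differentiable on I with g(s) < 0 for all s ∈ I, satisfying 2s·g(s) + s(1 + s²)·g(s)³ + (1 + s²)·g'(s) = 0 for all s ∈ I. Then there exists a constant C ∈ ℝ such that for all s ∈ I one has C(1 + s²)² − (1 + s²) > 0 and g(s) = −(C(1 + s²)² − (1 + s²))^(−1/2); equivalently, g(s) = −(C − 1 + (2C − 1)s² + C·s⁴)^(−1/2). -/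
noncomputable section

/-- Every negative differentiable solution on a nonempty open interval `I` of the
Bernoulli-type equation `2s g + s(1+s²) g³ + (1+s²) g' = 0` is of the form
`g(s) = -(C(1+s²)² - (1+s²))^(-1/2) = -(C - 1 + (2C - 1)s² + C s⁴)^(-1/2)` for some
constant `C`, with `C(1+s²)² - (1+s²) > 0` on `I`. -/
theorem bernoulli_solutions_classified (I : Set ℝ) (hIopen : IsOpen I)
    (hIinterval : I.OrdConnected) (hIne : I.Nonempty)
    (g : ℝ → ℝ) (hgdiff : ∀ s ∈ I, DifferentiableAt ℝ g s)
    (hgneg : ∀ s ∈ I, g s < 0)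
    (hode : ∀ s ∈ I,
      2 * s * g s + s * (1 + s ^ 2) * g s ^ 3 + (1 + s ^ 2) * deriv g s = 0) :
    ∃ C : ℝ, ∀ s ∈ I,
      0 < C * (1 + s ^ 2) ^ 2 - (1 + s ^ 2) ∧
      g s = -(C * (1 + s ^ 2) ^ 2 - (1 + s ^ 2)) ^ (-(1 / 2) : ℝ) ∧
      g s = -(C - 1 + (2 * C - 1) * s ^ 2 + C * s ^ 4) ^ (-(1 / 2) : ℝ) := by
  have hw : ∀ s : ℝ, 1 + s ^ 2 ≠ 0 := fun s => by positivity
  have hd : ∀ s ∈ I, HasDerivAt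
      (fun s => ((g s ^ 2)⁻¹ + (1 + s ^ 2)) / (1 + s ^ 2) ^ 2) 0 s := by
    intro s hs
    have hg := (hgdiff s hs).hasDerivAt
    have hne : g s ≠ 0 := (hgneg s hs).ne
    have hW : HasDerivAt (fun s : ℝ => 1 + s ^ 2) (2 * s) s := by
      simpa using ((hasDerivAt_id s).pow 2).const_add 1
    have h1 := (((hg.pow 2).inv (pow_ne_zero 2 hne)).add hW).div (hW.pow 2)
      (pow_ne_zero 2 (hw s))
    have hg' : deriv g s = -(2 * s * g s + s * (1 + s ^ 2) * g s ^ 3) / (1 + s ^ 2) := by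
      rw [eq_div_iff (hw s)]
      linarith [hode s hs]
    refine h1.congr_deriv ?_
    have := hw s
    simp only [Pi.pow_apply, Pi.add_apply, Pi.inv_apply]
    rw [hg']
    norm_num
    left
    field_simp
    ring
  obtain ⟨C, hC⟩ := hIopen.exists_is_const_of_deriv_eq_zero hIinterval.isPreconnected
    (fun s hs => (hd s hs).differentiableAt.differentiableWithinAt)
    (fun s hs => (hd s hs).deriv)
  refine ⟨C, fun s hs => ?_⟩
  have hn := hgneg s hs
  have hX : C * (1 + s ^ 2) ^ 2 - (1 + s ^ 2) = (g s ^ 2)⁻¹ := by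
    have h := hC s hs
    rw [div_eq_iff (pow_ne_zero 2 (hw s))] at h
    linarith
  have hY : C - 1 + (2 * C - 1) * s ^ 2 + C * s ^ 4 = (g s ^ 2)⁻¹ := by
    rw [← hX]; ring
  have hp : 0 < g s ^ 2 := by nlinarith
  have hR : g s = -((g s ^ 2)⁻¹) ^ (-(1 / 2) : ℝ) := by
    rw [Real.rpow_neg (by positivity), Real.inv_rpow hp.le, inv_inv, ← Real.sqrt_eq_rpow,
      Real.sqrt_sq_eq_abs, abs_of_neg hn, neg_neg]
  rw [hX, hY]
  exact ⟨by positivity, hR, hR⟩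

end
end
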